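/- arXiv:1712.07202 — 3 statements merged into one kernel-verified Lean document; each statement's English description precedes it below -/
import Mathlib

section
/- Let π be a maximizer of the Nash functional F over Borel probability measures on X × Y with second marginal ν. Then every integral ∫_Y s(p_i, y) dν_i(y) is strictly positive, and for every pair of indices i, j and every point y₁ ∈ Y with (p_i, y₁) in the support of π, one has s(p_i, y₁) / ∫_Y s(p_i, y) dν_i(y) ≥ s(p_j, y₁) / ∫_Y s(p_j, y) dν_j(y). -/
open MeasureTheory

/-- The measure `ν_i(B) = π({p_i} × B)` describing player `i`'s allocation. -/
noncomputable def nuI {Y : Type*} [MeasurableSpace Y] {N : ℕ}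
    (π : Measure (Fin N × Y)) (i : Fin N) : Measure Y :=
  (π.restrict ({i} ×ˢ (Set.univ : Set Y))).map Prod.snd

/-- The Nash functional `F(π) = ln N + (1/N) ∑ᵢ ln ∫ s(pᵢ,y) dνᵢ(y)`, equal to `⊥ = -∞`
if some of the integrals vanishes. -/
noncomputable def NashF {Y : Type*} [MeasurableSpace Y] {N : ℕ}
    (s : Fin N → Y → ℝ) (π : Measure (Fin N × Y)) : EReal :=
  if ∀ i : Fin N, 0 < ∫ y, s i y ∂(nuI π i) then
    ((Real.log N + (1 / (N : ℝ)) * ∑ i : Fin N, Real.log (∫ y, s i y ∂(nuI π i)) : ℝ) : EReal)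
  else ⊥

section NashHelpers

variable {Y : Type*} [MeasurableSpace Y] {N : ℕ}

/-- The mass that player `i` receives from a set, in terms of the joint measure. -/
lemma nuI_apply (π : Measure (Fin N × Y)) (i : Fin N) {U : Set Y} (hU : MeasurableSet U) :
    nuI π i U = π ({i} ×ˢ U) := by
  rw [nuI, Measure.map_apply measurable_snd hU, Measure.restrict_apply (measurable_snd hU)]
  congr 1
  ext p
  simp [and_comm]

/-- Integrals against `nuI π i` are integrals against `π` of a function living on one slice. -/
lemma integral_nuI (π : Measure (Fin N × Y)) (i : Fin N) {f : Y → ℝ} (hf : Measurable f) :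
    ∫ y, f y ∂(nuI π i) =
      ∫ p, ({i} ×ˢ Set.univ : Set (Fin N × Y)).indicator (fun p => f p.2) p ∂π := by
  rw [nuI, integral_map measurable_snd.aemeasurable hf.aestronglyMeasurable,
    integral_indicator ((measurableSet_singleton i).prod MeasurableSet.univ)]

lemma nuI_prod (m : Measure (Fin N)) [SFinite m] (ν : Measure Y) [SFinite ν] (i : Fin N) :
    nuI (m.prod ν) i = m {i} • ν := by
  rw [nuI, ← Measure.prod_restrict, Measure.restrict_univ, Measure.map_snd_prod]
  simp

/-- Move the fraction `t` of the mass that `π` puts on `A` to player `j`. -/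
noncomputable def transferMass (π : Measure (Fin N × Y)) (A : Set (Fin N × Y)) (j : Fin N)
    (t : ℝ) : Measure (Fin N × Y) :=
  π.restrict Aᶜ + (ENNReal.ofReal (1 - t) • π.restrict A +
    ENNReal.ofReal t • (π.restrict A).map (fun p => (j, p.2)))

lemma map_snd_transferMass (π : Measure (Fin N × Y)) {A : Set (Fin N × Y)} (hA : MeasurableSet A)
    (j : Fin N) {t : ℝ} (h0 : 0 ≤ t) (h1 : t ≤ 1) :
    (transferMass π A j t).map Prod.snd = π.map Prod.snd := by
  have hg : Measurable (fun p : Fin N × Y => (j, p.2)) := by fun_prop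
  have hcomp : (Prod.snd ∘ fun p : Fin N × Y => (j, p.2)) = Prod.snd := rfl
  rw [transferMass, Measure.map_add _ _ measurable_snd, Measure.map_add _ _ measurable_snd,
    Measure.map_smul, Measure.map_smul, Measure.map_map measurable_snd hg, hcomp, ← add_smul,
    ← ENNReal.ofReal_add (by linarith) h0, sub_add_cancel, ENNReal.ofReal_one, one_smul,
    ← Measure.map_add _ _ measurable_snd, Measure.restrict_compl_add_restrict hA]

lemma integral_transferMass (π : Measure (Fin N × Y)) {A : Set (Fin N × Y)}
    (hA : MeasurableSet A) (j : Fin N) {t : ℝ} (h0 : 0 ≤ t) (h1 : t ≤ 1)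
    {g : Fin N × Y → ℝ} (hgm : Measurable g) (hg : Integrable g π)
    (hgj : Integrable (fun p => g (j, p.2)) π) :
    ∫ p, g p ∂(transferMass π A j t) =
      ∫ p, g p ∂π - t * ∫ p in A, g p ∂π + t * ∫ p in A, g (j, p.2) ∂π := by
  have hm : Measurable (fun p : Fin N × Y => (j, p.2)) := by fun_prop
  have hmap : Integrable g ((π.restrict A).map (fun p => (j, p.2))) :=
    (integrable_map_measure hgm.aestronglyMeasurable hm.aemeasurable).2 hgj.restrict
  have hi1 := (hg.restrict (s := A)).smul_measure (c := ENNReal.ofReal (1 - t))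
    ENNReal.ofReal_ne_top
  have hi2 := hmap.smul_measure (c := ENNReal.ofReal t) ENNReal.ofReal_ne_top
  rw [transferMass, integral_add_measure hg.restrict (hi1.add_measure hi2),
    integral_add_measure hi1 hi2, integral_smul_measure, integral_smul_measure,
    integral_map hm.aemeasurable hgm.aestronglyMeasurable,
    ENNReal.toReal_ofReal (by linarith), ENNReal.toReal_ofReal h0,
    ← integral_add_compl hA hg]
  simp only [smul_eq_mul]
  ring

lemma isProbabilityMeasure_of_map_snd {π : Measure (Fin N × Y)}
    {ν : Measure Y} [IsProbabilityMeasure ν] (h : π.map Prod.snd = ν) :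
    IsProbabilityMeasure π := by
  subst h
  exact Measure.isProbabilityMeasure_of_map Prod.snd

/-- A comparison of values of the Nash functional, for positive utilities, is a comparison of
sums of logarithms. -/
lemma sum_log_le_of_nashF_le (hN : 0 < N) {s : Fin N → Y → ℝ} {π π' : Measure (Fin N × Y)}
    (h : ∀ i, 0 < ∫ y, s i y ∂(nuI π i)) (h' : ∀ i, 0 < ∫ y, s i y ∂(nuI π' i))
    (hle : NashF s π' ≤ NashF s π) :
    ∑ i, Real.log (∫ y, s i y ∂(nuI π' i)) ≤ ∑ i, Real.log (∫ y, s i y ∂(nuI π i)) := by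
  rw [NashF, NashF, if_pos h, if_pos h', EReal.coe_le_coe_iff] at hle
  have hN' : (0 : ℝ) < 1 / N := by positivity
  exact le_of_mul_le_mul_left (by linarith) hN'

end NashHelpers

/-- Continuous functions of the second coordinate are integrable when that factor is compact. -/
lemma integrable_comp_snd_of_continuous {Y : Type*} [MetricSpace Y] [CompactSpace Y]
    [MeasurableSpace Y] [BorelSpace Y] {N : ℕ} (π : Measure (Fin N × Y)) [IsFiniteMeasure π]
    {f : Y → ℝ} (hf : Continuous f) : Integrable (fun p : Fin N × Y => f p.2) π := by
  obtain ⟨C, hC⟩ := isCompact_univ.exists_bound_of_continuousOn hf.continuousOn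
  exact Integrable.of_bound (hf.measurable.comp measurable_snd).aestronglyMeasurable C
    (.of_forall fun p => hC p.2 (Set.mem_univ _))

/-- Some small step strictly increases a product of two linear functions when the derivative at
zero is positive. -/
lemma exists_step_mul_lt {a b I J : ℝ} (ha : 0 < a) (hb : 0 < b)
    (h : a * J < b * I) : ∃ t, 0 < t ∧ t < 1 ∧ I * J < (I - t * a) * (J + t * b) := by
  have hab : 0 < a * b := mul_pos ha hb
  set c := b * I - a * J with hc
  have hcpos : 0 < c := by linarith
  have hd : 0 < c + a * b := by linarith
  refine ⟨c / (c + a * b), by positivity, (div_lt_one hd).2 (by linarith), ?_⟩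
  set t := c / (c + a * b) with ht
  have htpos : 0 < t := by positivity
  have hte : t * (c + a * b) = c := by rw [ht]; field_simp
  have : (I - t * a) * (J + t * b) - I * J = t * (t * c) := by
    linear_combination (-t) * hte
  have : 0 < t * (t * c) := by positivity
  linarith

/-- at a maximizer `π` of the Nash functional, every utility integral is
positive, and for all players `i, j` and any point `y₁` with `(p_i, y₁)` in the support
of `π` (i.e. every open neighborhood of `y₁` has positive `ν_i`-measure),
`s(p_i,y₁)/∫ s(p_i,·) dν_i ≥ s(p_j,y₁)/∫ s(p_j,·) dν_j`. -/
theorem nash_maximizer_support_inequality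
    {Y : Type*} [MetricSpace Y] [CompactSpace Y] [MeasurableSpace Y] [BorelSpace Y]
    (ν : Measure Y) [IsProbabilityMeasure ν] {N : ℕ} (hN : 0 < N)
    (s : Fin N → Y → ℝ) (hs : ∀ i, Continuous (s i)) (hpos : ∀ i y, 0 < s i y)
    (π : Measure (Fin N × Y)) (hπ : IsProbabilityMeasure π) (hmarg : π.map Prod.snd = ν)
    (hmax : ∀ π' : Measure (Fin N × Y), IsProbabilityMeasure π' → π'.map Prod.snd = ν →
      NashF s π' ≤ NashF s π) :
    (∀ i : Fin N, 0 < ∫ y, s i y ∂(nuI π i)) ∧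
    (∀ i j : Fin N, ∀ y₁ : Y,
      (∀ U : Set Y, IsOpen U → y₁ ∈ U → 0 < nuI π i U) →
      s j y₁ / ∫ y, s j y ∂(nuI π j) ≤ s i y₁ / ∫ y, s i y ∂(nuI π i)) := by
  classical
  have hmeas : ∀ i, Measurable (s i) := fun i => (hs i).measurable
  have hpos_int : ∀ i : Fin N, 0 < ∫ y, s i y ∂(nuI π i) := by
    by_contra hcon
    have hint : ∀ i, Integrable (s i) ν := fun i => by
      rw [← hmarg, integrable_map_measure (hmeas i).aestronglyMeasurable
        measurable_snd.aemeasurable]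
      exact integrable_comp_snd_of_continuous π (hs i)
    set m : Measure (Fin N) := (N : ENNReal)⁻¹ • Measure.count with hm
    have hN0 : (N : ENNReal) ≠ 0 := by exact_mod_cast hN.ne'
    have hfst : m Set.univ = 1 := by
      simp [hm, Measure.count_univ, ENNReal.inv_mul_cancel hN0 (ENNReal.natCast_ne_top N)]
    have hmp : IsProbabilityMeasure m := ⟨hfst⟩
    have hle := hmax (m.prod ν) inferInstance (by simp [Measure.map_snd_prod])
    have h' : ∀ i : Fin N, 0 < ∫ y, s i y ∂(nuI (m.prod ν) i) := fun i => by
      rw [nuI_prod, integral_smul_measure, smul_eq_mul]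
      refine mul_pos ?_ ?_
      · simpa [hm] using hN
      · rw [integral_pos_iff_support_of_nonneg (fun y => (hpos i y).le) (hint i),
          Function.support_eq_univ fun y => (hpos i y).ne']
        simp
    rw [NashF, NashF, if_pos h', if_neg hcon, le_bot_iff] at hle
    exact EReal.coe_ne_bot _ hle
  refine ⟨hpos_int, fun i j y₁ hsupp => ?_⟩
  by_contra! hlt
  have hij : i ≠ j := by
    rintro rfl
    exact lt_irrefl _ hlt
  set I : Fin N → ℝ := fun k => ∫ y, s k y ∂(nuI π k) with hI
  set U : Set Y := {y | s i y / I i < s j y / I j} with hU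
  have hUo : IsOpen U := isOpen_lt ((hs i).div_const _) ((hs j).div_const _)
  set A : Set (Fin N × Y) := {i} ×ˢ U with hA
  have hAm : MeasurableSet A := (measurableSet_singleton i).prod hUo.measurableSet
  have hApos : 0 < π A := by
    rw [← nuI_apply π i hUo.measurableSet]
    exact hsupp U hUo hlt
  have hsi : ∀ k, Integrable (fun p : Fin N × Y => s k p.2) π :=
    fun k => integrable_comp_snd_of_continuous π (hs k)
  have setInt_pos : ∀ f : Fin N × Y → ℝ, Integrable f π → (∀ p ∈ A, 0 < f p) →
      0 < ∫ p in A, f p ∂π := fun f hf hfp => by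
    rw [setIntegral_pos_iff_support_of_nonneg_ae
      ((ae_restrict_iff' hAm).2 (.of_forall fun p hp => (hfp p hp).le)) hf.integrableOn,
      Set.inter_eq_right.2 (show A ⊆ Function.support f from fun p hp => (hfp p hp).ne')]
    exact hApos
  set a := ∫ p in A, s i p.2 ∂π with ha
  set b := ∫ p in A, s j p.2 ∂π with hb
  have ha0 : 0 < a := setInt_pos _ (hsi i) fun p _ => hpos i p.2
  have hb0 : 0 < b := setInt_pos _ (hsi j) fun p _ => hpos j p.2
  have hab : a * I j < b * I i := by
    have := setInt_pos (fun p => s j p.2 * I i - s i p.2 * I j)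
      (((hsi j).mul_const _).sub ((hsi i).mul_const _)) (fun p hp => by
        have h2 : s i p.2 / I i < s j p.2 / I j := hp.2
        rw [div_lt_div_iff₀ (hpos_int i) (hpos_int j)] at h2
        linarith)
    rw [integral_sub ((hsi j).mul_const _).restrict ((hsi i).mul_const _).restrict,
      integral_mul_const, integral_mul_const] at this
    linarith
  set g : Fin N → Fin N × Y → ℝ := fun k =>
    ({k} ×ˢ Set.univ : Set (Fin N × Y)).indicator (fun p => s k p.2) with hg
  have hslice : ∀ k : Fin N, MeasurableSet ({k} ×ˢ Set.univ : Set (Fin N × Y)) := fun k =>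
    (measurableSet_singleton k).prod MeasurableSet.univ
  have hgm : ∀ k, Measurable (g k) := fun k =>
    ((hmeas k).comp measurable_snd).indicator (hslice k)
  have hgi : ∀ k, Integrable (g k) π := fun k => (hsi k).indicator (hslice k)
  have hgj : ∀ k p, g k (j, p) = if k = j then s k p else 0 := fun k p => by
    simp [hg, Set.indicator_apply, eq_comm]
  have hgji : ∀ k, Integrable (fun p : Fin N × Y => g k (j, p.2)) π := fun k => by
    simp only [hgj]
    split_ifs
    · exact hsi k
    · exact integrable_zero _ _ _
  have hgA : ∀ k, ∫ p in A, g k p ∂π = ∫ p in A, (if k = i then s k p.2 else 0) ∂π := fun k =>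
    setIntegral_congr_fun hAm fun p hp => by
      have : p.1 = i := hp.1
      simp [hg, Set.indicator_apply, this, eq_comm]
  obtain ⟨t, ht0, ht1, hstep⟩ := exists_step_mul_lt ha0 hb0 hab
  have hmarg' := (map_snd_transferMass π hAm j ht0.le ht1.le).trans hmarg
  have hI' : ∀ k, ∫ y, s k y ∂(nuI (transferMass π A j t) k) =
      I k - t * (if k = i then a else 0) + t * (if k = j then b else 0) := fun k => by
    rw [integral_nuI _ k (hmeas k), integral_transferMass π hAm j ht0.le ht1.le (hgm k) (hgi k)
      (hgji k), hgA]
    simp only [hI, integral_nuI π k (hmeas k), hgj]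
    congr 2
    · congr 1
      split_ifs with h
      · rw [h]
      · simp
    · split_ifs with h
      · rw [h]
      · simp
  have hIi : ∫ y, s i y ∂(nuI (transferMass π A j t) i) = I i - t * a := by
    rw [hI']; simp [hij]
  have hIj : ∫ y, s j y ∂(nuI (transferMass π A j t) j) = I j + t * b := by
    rw [hI']; simp [hij.symm]
  have hIk : ∀ k, k ≠ i ∧ k ≠ j → ∫ y, s k y ∂(nuI (transferMass π A j t) k) = I k :=
    fun k hk => by rw [hI']; simp [hk.1, hk.2]
  have hjpos : 0 < I j + t * b := add_pos (hpos_int j) (mul_pos ht0 hb0)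
  have hipos : 0 < I i - t * a :=
    pos_of_mul_pos_left ((mul_pos (hpos_int i) (hpos_int j)).trans hstep) hjpos.le
  have hpos' : ∀ k, 0 < ∫ y, s k y ∂(nuI (transferMass π A j t) k) := fun k => by
    by_cases hki : k = i
    · rw [hki, hIi]; exact hipos
    by_cases hkj : k = j
    · rw [hkj, hIj]; exact hjpos
    rw [hIk k ⟨hki, hkj⟩]
    exact hpos_int k
  have hsum := sum_log_le_of_nashF_le hN hpos_int hpos'
    (hmax _ (isProbabilityMeasure_of_map_snd hmarg') hmarg')
  rw [← sub_nonpos, ← Finset.sum_sub_distrib, Finset.sum_eq_add i j hij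
    (fun k _ hk => by rw [hIk k hk, sub_self]) (by simp) (by simp), hIi, hIj] at hsum
  have hlog := Real.log_lt_log (mul_pos (hpos_int i) (hpos_int j)) hstep
  rw [Real.log_mul (hpos_int i).ne' (hpos_int j).ne', Real.log_mul hipos.ne' hjpos.ne'] at hlog
  linarith
end

section
/- Let X and Y be compact metric spaces, c : X × Y → ℝ continuous, and ν a Borel probability measure on Y. Suppose (α_N) are Borel probability measures on X converging weakly to α, and for each N, π_N is an optimal transport plan between α_N and ν for the cost c, i.e. π_N attains W_c(α_N, ν). If π_N converges weakly to a measure π, then π is an optimal transport plan between α and ν, and ∫ c dπ = W_c(α, ν) = lim_N W_c(α_N, ν). -/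
open MeasureTheory

/-- The optimal transport cost `W_c(μ, β)`: infimum of `∫ c dπ` over all probability
measures `π` with first marginal `μ` and second marginal `β`. -/
noncomputable def Wcost {X Y : Type*} [MeasurableSpace X] [MeasurableSpace Y]
    (c : X → Y → ℝ) (μ : Measure X) (β : Measure Y) : ℝ :=
  sInf {r : ℝ | ∃ π : Measure (X × Y), IsProbabilityMeasure π ∧
    π.map Prod.fst = μ ∧ π.map Prod.snd = β ∧ r = ∫ p, c p.1 p.2 ∂π}

open Filter Topology

/-- On a compact metric space there are finite continuous partitions of unity whose members
have arbitrarily small support. -/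
lemma exists_finite_partition_of_unity_small {X : Type*} [MetricSpace X] [CompactSpace X]
    {δ : ℝ} (hδ : 0 < δ) :
    ∃ (t : Finset X) (φ : t → X → ℝ), (∀ i, Continuous (φ i)) ∧ (∀ i x, 0 ≤ φ i x) ∧
      (∀ x, ∑ i, φ i x = 1) ∧ ∀ i x x', φ i x ≠ 0 → φ i x' ≠ 0 → dist x x' < δ := by
  obtain ⟨t, ht⟩ := isCompact_univ.elim_finite_subcover
    (fun i : X => Metric.ball i (δ / 2)) (fun _ => Metric.isOpen_ball)
    (fun x _ => Set.mem_iUnion.2 ⟨x, Metric.mem_ball_self (half_pos hδ)⟩)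
  obtain ⟨f, hf⟩ := PartitionOfUnity.exists_isSubordinate (s := (Set.univ : Set X))
    isClosed_univ (fun i : t => Metric.ball (i : X) (δ / 2)) (fun _ => Metric.isOpen_ball)
    (fun x hx => by simpa using ht hx)
  refine ⟨t, fun i => f i, fun i => (f i).continuous, fun i x => f.nonneg i x, fun x => ?_,
    fun i x x' hx hx' => ?_⟩
  · rw [← finsum_eq_sum_of_fintype]
    exact f.sum_eq_one (Set.mem_univ x)
  · have h := hf i (subset_tsupport _ hx)
    have h' := hf i (subset_tsupport _ hx')
    rw [Metric.mem_ball] at h h'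
    linarith [dist_triangle_right x x' (i : X)]

/-- A continuous function on a compact space is integrable for any finite measure. -/
lemma Continuous.integrable_of_compactSpace {Z : Type*} [TopologicalSpace Z] [CompactSpace Z]
    [MeasurableSpace Z] [OpensMeasurableSpace Z] {μ : Measure Z} [IsFiniteMeasure μ]
    {f : Z → ℝ} (hf : Continuous f) : Integrable f μ := by
  obtain ⟨C, hC⟩ := isCompact_univ.exists_bound_of_continuousOn hf.continuousOn
  exact Integrable.of_bound hf.measurable.aestronglyMeasurable C
    (Eventually.of_forall fun z => hC z (Set.mem_univ z))

lemma Wcost_le_integral {X Y : Type*} [TopologicalSpace X] [CompactSpace X] [MeasurableSpace X]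
    [TopologicalSpace Y] [CompactSpace Y] [MeasurableSpace Y]
    {c : X → Y → ℝ} (hc : Continuous fun p : X × Y => c p.1 p.2)
    {μ : Measure X} {ν : Measure Y} (ρ : Measure (X × Y)) [IsProbabilityMeasure ρ]
    (h₁ : ρ.map Prod.fst = μ) (h₂ : ρ.map Prod.snd = ν) :
    Wcost c μ ν ≤ ∫ p, c p.1 p.2 ∂ρ := by
  obtain ⟨M, hM⟩ := isCompact_univ.exists_bound_of_continuousOn hc.continuousOn
  refine csInf_le ⟨-M, ?_⟩ ⟨ρ, inferInstance, h₁, h₂, rfl⟩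
  rintro _ ⟨τ, hτ, -, -, rfl⟩
  have h := norm_integral_le_of_norm_le_const (μ := τ)
    (Eventually.of_forall fun p => hM p (Set.mem_univ p))
  simp only [probReal_univ, mul_one] at h
  exact neg_le_of_abs_le h

section Coupling

variable {X Y : Type*} [MetricSpace X] [CompactSpace X] [MeasurableSpace X] [BorelSpace X]
  [MetricSpace Y] [CompactSpace Y] [MeasurableSpace Y] [BorelSpace Y]

/-- A density `T` on `X × X` with unit marginals with respect to `β` and `α` transfers couplings
of `α` and `ν` to couplings of `β` and `ν`. -/
lemma Wcost_le_integral_density {c : X → Y → ℝ} (hc : Continuous fun p : X × Y => c p.1 p.2)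
    {α β : Measure X} {ν : Measure Y} [IsProbabilityMeasure β]
    (σ : Measure (X × Y)) [IsProbabilityMeasure σ]
    (h₁ : σ.map Prod.fst = α) (h₂ : σ.map Prod.snd = ν)
    {T : X → X → ℝ} (hT : Continuous fun q : X × X => T q.1 q.2) (hT0 : ∀ x x', 0 ≤ T x x')
    (hTα : ∀ x, ∫ x', T x x' ∂α = 1) (hTβ : ∀ x', ∫ x, T x x' ∂β = 1) :
    Wcost c β ν ≤ ∫ q, T q.1 q.2.1 * c q.1 q.2.2 ∂(β.prod σ) := by
  have hα : IsProbabilityMeasure α := h₁ ▸ Measure.isProbabilityMeasure_map (by fun_prop)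
  have hTc : Continuous fun q : X × (X × Y) => T q.1 q.2.1 :=
    hT.comp (by fun_prop : Continuous fun q : X × (X × Y) => (q.1, q.2.1))
  have hTm : Measurable fun q : X × (X × Y) => ENNReal.ofReal (T q.1 q.2.1) :=
    hTc.measurable.ennreal_ofReal
  have hTα' : ∀ x, ∫⁻ p, ENNReal.ofReal (T x p.1) ∂σ = 1 := fun x => by
    have hx : Continuous (T x) := hT.comp (by fun_prop : Continuous fun x' => (x, x'))
    have h : ∫⁻ x', ENNReal.ofReal (T x x') ∂α = 1 := by
      rw [← ofReal_integral_eq_lintegral_ofReal hx.integrable_of_compactSpace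
        (Eventually.of_forall (hT0 x)), hTα, ENNReal.ofReal_one]
    rwa [← h₁, lintegral_map hx.measurable.ennreal_ofReal measurable_fst] at h
  have hTβ' : ∀ x', ∫⁻ x, ENNReal.ofReal (T x x') ∂β = 1 := fun x' => by
    have hx : Continuous fun x => T x x' := hT.comp (by fun_prop : Continuous fun x => (x, x'))
    rw [← ofReal_integral_eq_lintegral_ofReal hx.integrable_of_compactSpace
      (Eventually.of_forall fun x => hT0 x x'), hTβ, ENNReal.ofReal_one]
  set τ := (β.prod σ).withDensity fun q => ENNReal.ofReal (T q.1 q.2.1) with hτ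
  have hm : Measurable fun q : X × (X × Y) => (q.1, q.2.2) := by fun_prop
  have hfst : (τ.map fun q => (q.1, q.2.2)).map Prod.fst = β := by
    rw [Measure.map_map measurable_fst hm]
    refine Measure.ext_of_lintegral _ fun f hf => ?_
    rw [lintegral_map hf (measurable_fst.comp hm), hτ]
    refine (lintegral_withDensity_eq_lintegral_mul _ hTm
      (hf.comp (measurable_fst.comp hm))).trans ?_
    rw [lintegral_prod _ (hTm.mul (hf.comp (measurable_fst.comp hm))).aemeasurable]
    refine lintegral_congr fun x => ?_
    simp only [Pi.mul_apply, Function.comp_apply]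
    rw [lintegral_mul_const, hTα', one_mul]
    exact hTm.comp measurable_prodMk_left
  have hsnd : (τ.map fun q => (q.1, q.2.2)).map Prod.snd = ν := by
    rw [Measure.map_map measurable_snd hm]
    refine Measure.ext_of_lintegral _ fun f hf => ?_
    rw [lintegral_map hf (measurable_snd.comp hm), hτ]
    refine (lintegral_withDensity_eq_lintegral_mul _ hTm
      (hf.comp (measurable_snd.comp hm))).trans ?_
    rw [lintegral_prod_symm _ (hTm.mul (hf.comp (measurable_snd.comp hm))).aemeasurable,
      ← h₂, lintegral_map hf measurable_snd]
    refine lintegral_congr fun p => ?_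
    simp only [Pi.mul_apply, Function.comp_apply]
    rw [lintegral_mul_const, hTβ', one_mul]
    exact hTm.comp (measurable_prodMk_right (y := p))
  have hprob : IsProbabilityMeasure (τ.map fun q => (q.1, q.2.2)) :=
    ⟨by
      have h := congrArg (fun μ : Measure X => μ Set.univ) hfst
      simpa only [Measure.map_apply measurable_fst MeasurableSet.univ, Set.preimage_univ,
        measure_univ] using h⟩
  refine (Wcost_le_integral hc _ hfst hsnd).trans_eq ?_
  rw [integral_map hm.aemeasurable hc.measurable.aestronglyMeasurable, hτ,
    integral_withDensity_eq_integral_toReal_smul hTm (by simp)]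
  refine integral_congr_ae (Eventually.of_forall fun q => ?_)
  simp only [ENNReal.toReal_ofReal (hT0 _ _), smul_eq_mul]

/-- If `T = K + R` has unit marginals, `K` only charges pairs on which the cost
varies by at most `ε`, and `R` has total mass `s`, then moving the first marginal of a coupling
along `T` raises the cost by at most `ε + 2 M s`. -/
lemma Wcost_le_add_of_density {c : X → Y → ℝ} (hc : Continuous fun p : X × Y => c p.1 p.2)
    {α β : Measure X} {ν : Measure Y} [IsProbabilityMeasure β]
    (σ : Measure (X × Y)) [IsProbabilityMeasure σ]
    (h₁ : σ.map Prod.fst = α) (h₂ : σ.map Prod.snd = ν)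
    {K R : X → X → ℝ} (hK : Continuous fun q : X × X => K q.1 q.2)
    (hR : Continuous fun q : X × X => R q.1 q.2) (hK0 : ∀ x x', 0 ≤ K x x')
    (hR0 : ∀ x x', 0 ≤ R x x')
    (hα : ∀ x, ∫ x', (K x x' + R x x') ∂α = 1) (hβ : ∀ x', ∫ x, (K x x' + R x x') ∂β = 1)
    {ε M s : ℝ} (hε : 0 ≤ ε) (hM : ∀ x y, |c x y| ≤ M)
    (hKc : ∀ x x' y, K x x' ≠ 0 → c x y - c x' y ≤ ε)
    (hs : ∫ x', ∫ x, R x x' ∂β ∂α = s) :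
    Wcost c β ν ≤ ∫ p, c p.1 p.2 ∂σ + ε + 2 * M * s := by
  have hαp : IsProbabilityMeasure α := h₁ ▸ Measure.isProbabilityMeasure_map (by fun_prop)
  refine (Wcost_le_integral_density hc σ h₁ h₂ (hK.add hR)
    (fun x x' => add_nonneg (hK0 x x') (hR0 x x')) hα hβ).trans ?_
  have hproj : Continuous fun q : X × (X × Y) => (q.1, q.2.1) := by fun_prop
  have hK' : Continuous fun q : X × (X × Y) => K q.1 q.2.1 := hK.comp hproj
  have hR' : Continuous fun q : X × (X × Y) => R q.1 q.2.1 := hR.comp hproj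
  have hc₁ : Continuous fun q : X × (X × Y) => c q.1 q.2.2 :=
    hc.comp (by fun_prop : Continuous fun q : X × (X × Y) => (q.1, q.2.2))
  have hc₂ : Continuous fun q : X × (X × Y) => c q.2.1 q.2.2 :=
    hc.comp (by fun_prop : Continuous fun q : X × (X × Y) => q.2)
  have hT' : Continuous fun q : X × (X × Y) => K q.1 q.2.1 + R q.1 q.2.1 := hK'.add hR'
  have hI : Continuous fun q : X × (X × Y) =>
      (K q.1 q.2.1 + R q.1 q.2.1) * (c q.2.1 q.2.2 + ε) := hT'.mul (hc₂.add continuous_const)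
  have hRI : Integrable (fun q : X × (X × Y) => R q.1 q.2.1) (β.prod σ) :=
    hR'.integrable_of_compactSpace
  have key : ∫ q, (K q.1 q.2.1 + R q.1 q.2.1) * c q.1 q.2.2 ∂(β.prod σ) ≤
      ∫ q, ((K q.1 q.2.1 + R q.1 q.2.1) * (c q.2.1 q.2.2 + ε) + 2 * M * R q.1 q.2.1)
        ∂(β.prod σ) := by
    refine integral_mono (hT'.mul hc₁).integrable_of_compactSpace
      (hI.integrable_of_compactSpace.add (hRI.const_mul _)) fun q => ?_
    have hKq : K q.1 q.2.1 * (c q.1 q.2.2 - c q.2.1 q.2.2 - ε) ≤ 0 := by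
      by_cases h : K q.1 q.2.1 = 0
      · simp [h]
      · exact mul_nonpos_of_nonneg_of_nonpos (hK0 _ _) (by linarith [hKc q.1 q.2.1 q.2.2 h])
    have hRq : R q.1 q.2.1 * (c q.1 q.2.2 - c q.2.1 q.2.2 - ε - 2 * M) ≤ 0 :=
      mul_nonpos_of_nonneg_of_nonpos (hR0 _ _)
        (by linarith [(abs_le.1 (hM q.1 q.2.2)).2, (abs_le.1 (hM q.2.1 q.2.2)).1])
    dsimp only
    linarith
  refine key.trans_eq ?_
  rw [integral_add hI.integrable_of_compactSpace (hRI.const_mul _), integral_const_mul,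
    integral_prod_symm _ hI.integrable_of_compactSpace, integral_prod_symm _ hRI]
  simp only [integral_mul_const, hβ, one_mul]
  rw [integral_add hc.integrable_of_compactSpace (integrable_const _), integral_const,
    probReal_univ, one_smul, ← hs, ← h₁, integral_map measurable_fst.aemeasurable]
  rw [h₁]
  exact ((hR.comp continuous_swap).aestronglyMeasurable (μ := α.prod β)).integral_prod_right'

/-- Quantitative upper semicontinuity of the transport cost in its first marginal, in terms of the
masses which a partition of unity receives. -/
lemma Wcost_le_of_partition {c : X → Y → ℝ} (hc : Continuous fun p : X × Y => c p.1 p.2)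
    {α β : Measure X} {ν : Measure Y} [IsProbabilityMeasure α] [IsProbabilityMeasure β]
    (σ : Measure (X × Y)) [IsProbabilityMeasure σ]
    (h₁ : σ.map Prod.fst = α) (h₂ : σ.map Prod.snd = ν)
    {ι : Type*} [Fintype ι] {φ : ι → X → ℝ} (hφ : ∀ i, Continuous (φ i))
    (hφ0 : ∀ i x, 0 ≤ φ i x) (hφ1 : ∀ x, ∑ i, φ i x = 1)
    {ε M : ℝ} (hε : 0 < ε) (hε1 : ε < 1) (hM : ∀ x y, |c x y| ≤ M)
    (hφc : ∀ i x x' y, φ i x ≠ 0 → φ i x' ≠ 0 → c x y - c x' y ≤ ε) :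
    Wcost c β ν ≤ ∫ p, c p.1 p.2 ∂σ + ε +
      2 * M * (1 - (1 - ε) * ∑ i, min (∫ x, φ i x ∂α) (∫ x, φ i x ∂β)) := by
  set a : ι → ℝ := fun i => ∫ x, φ i x ∂α with ha
  set b : ι → ℝ := fun i => ∫ x, φ i x ∂β with hb
  have ha0 : ∀ i, 0 ≤ a i := fun i => integral_nonneg (hφ0 i)
  have hb0 : ∀ i, 0 ≤ b i := fun i => integral_nonneg (hφ0 i)
  have hφα : ∀ i, Integrable (φ i) α := fun i => (hφ i).integrable_of_compactSpace
  have hφβ : ∀ i, Integrable (φ i) β := fun i => (hφ i).integrable_of_compactSpace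
  have hsum : ∑ i, a i = 1 := by
    rw [ha, ← integral_finsetSum _ fun i _ => hφα i]
    simp [hφ1]
  set θ : ι → ℝ := fun i => (1 - ε) / max (a i) (b i) with hθ
  have hmax0 : ∀ i, 0 ≤ max (a i) (b i) := fun i => (ha0 i).trans (le_max_left _ _)
  have hθ0 : ∀ i, 0 ≤ θ i := fun i => div_nonneg (by linarith) (hmax0 i)
  have hθle : ∀ i r, 0 ≤ r → r ≤ max (a i) (b i) → θ i * r ≤ 1 := fun i r hr h => by
    rw [hθ]
    dsimp only
    rw [div_mul_eq_mul_div]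
    exact div_le_one_of_le₀ (by nlinarith) (hmax0 i)
  have hθab : ∀ i, θ i * (a i * b i) = (1 - ε) * min (a i) (b i) := fun i => by
    rw [← min_mul_max (a i) (b i), hθ]
    dsimp only
    rcases (hmax0 i).eq_or_lt with h | h
    · have hmin : min (a i) (b i) = 0 :=
        le_antisymm (h ▸ min_le_max) (le_min (ha0 i) (hb0 i))
      simp [hmin]
    · field_simp
  have hsle : ∀ (r : ι → ℝ), (∀ i, 0 ≤ r i) → (∀ i, r i ≤ max (a i) (b i)) → ∀ x,
      0 ≤ 1 - ∑ i, θ i * r i * φ i x := fun r hr0 hr x => by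
    rw [sub_nonneg, ← hφ1 x]
    exact Finset.sum_le_sum fun i _ =>
      mul_le_of_le_one_left (hφ0 i x) (hθle i (r i) (hr0 i) (hr i))
  set s := 1 - (1 - ε) * ∑ i, min (a i) (b i) with hsdef
  have hs' : s = 1 - ∑ i, θ i * (a i * b i) := by
    rw [hsdef, Finset.mul_sum]
    simp only [hθab]
  have hspos : 0 < s := by
    have : ∑ i, min (a i) (b i) ≤ 1 := hsum ▸ Finset.sum_le_sum fun i _ => min_le_left _ _
    nlinarith
  have hAc : Continuous fun x => 1 - ∑ i, θ i * a i * φ i x := by fun_prop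
  have hBc : Continuous fun x => 1 - ∑ i, θ i * b i * φ i x := by fun_prop
  have hAβ : ∫ x, (1 - ∑ i, θ i * a i * φ i x) ∂β = s := by
    rw [integral_sub (integrable_const _)
      (integrable_finsetSum _ fun i _ => (hφβ i).const_mul _),
      integral_finsetSum _ fun i _ => (hφβ i).const_mul _]
    simp only [integral_const_mul, integral_const, probReal_univ, smul_eq_mul, mul_one, hs',
      mul_assoc]
    rfl
  have hBα : ∫ x, (1 - ∑ i, θ i * b i * φ i x) ∂α = s := by
    rw [integral_sub (integrable_const _)
      (integrable_finsetSum _ fun i _ => (hφα i).const_mul _),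
      integral_finsetSum _ fun i _ => (hφα i).const_mul _]
    simp only [integral_const_mul, integral_const, probReal_univ, smul_eq_mul, mul_one, hs',
      mul_assoc]
    exact congrArg _ (Finset.sum_congr rfl fun i _ => by rw [mul_comm (a i)])
  refine Wcost_le_add_of_density hc σ h₁ h₂
    (K := fun x x' => ∑ i, θ i * φ i x * φ i x')
    (R := fun x x' => (1 - ∑ i, θ i * a i * φ i x) * (1 - ∑ i, θ i * b i * φ i x') / s)
    (by fun_prop) (by fun_prop)
    (fun x x' => Finset.sum_nonneg fun i _ =>
      mul_nonneg (mul_nonneg (hθ0 i) (hφ0 i x)) (hφ0 i x'))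
    (fun x x' => div_nonneg (mul_nonneg (hsle a ha0 (fun i => le_max_left _ _) x)
      (hsle b hb0 (fun i => le_max_right _ _) x')) hspos.le)
    (fun x => ?_) (fun x' => ?_) hε.le hM (fun x x' y h => ?_) ?_
  · rw [integral_add (integrable_finsetSum _ fun i _ => (hφα i).const_mul _)
      ((hBc.integrable_of_compactSpace.const_mul _).div_const _),
      integral_finsetSum _ fun i _ => (hφα i).const_mul _, integral_div]
    simp only [integral_const_mul, hBα]
    rw [mul_div_cancel_right₀ _ hspos.ne', add_sub, add_comm, add_sub_assoc, add_eq_left,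
      sub_eq_zero]
    exact Finset.sum_congr rfl fun i _ => by ring
  · rw [integral_add
      (integrable_finsetSum _ fun i _ => ((hφβ i).const_mul _).mul_const _)
      ((hAc.integrable_of_compactSpace.mul_const _).div_const _),
      integral_finsetSum _ fun i _ => ((hφβ i).const_mul _).mul_const _, integral_div]
    simp only [integral_const_mul, integral_mul_const, hAβ]
    rw [mul_div_cancel_left₀ _ hspos.ne', add_sub, add_comm, add_sub_assoc, add_eq_left,
      sub_eq_zero]
  · obtain ⟨i, -, hi⟩ := Finset.exists_ne_zero_of_sum_ne_zero h
    exact hφc i x x' y (right_ne_zero_of_mul (left_ne_zero_of_mul hi)) (right_ne_zero_of_mul hi)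
  · simp only [integral_div, integral_mul_const, integral_const_mul, hAβ, hBα]
    rw [mul_div_cancel_right₀ _ hspos.ne']

/-- The optimal transport cost is upper semicontinuous in its first marginal. -/
lemma limit_Wcost_le_integral {c : X → Y → ℝ} (hc : Continuous fun p : X × Y => c p.1 p.2)
    {α' : ℕ → Measure X} [∀ n, IsProbabilityMeasure (α' n)]
    {α : Measure X} [IsProbabilityMeasure α] {ν : Measure Y}
    (hα : ∀ f : X → ℝ, Continuous f →
      Tendsto (fun n => ∫ x, f x ∂(α' n)) atTop (𝓝 (∫ x, f x ∂α)))
    (σ : Measure (X × Y)) [IsProbabilityMeasure σ]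
    (h₁ : σ.map Prod.fst = α) (h₂ : σ.map Prod.snd = ν)
    {L : ℝ} (hL : Tendsto (fun n => Wcost c (α' n) ν) atTop (𝓝 L)) :
    L ≤ ∫ p, c p.1 p.2 ∂σ := by
  obtain ⟨M, hM⟩ := isCompact_univ.exists_bound_of_continuousOn hc.continuousOn
  have hε : ∀ ε : ℝ, 0 < ε → ε < 1 → L ≤ ∫ p, c p.1 p.2 ∂σ + ε + 2 * M * ε := by
    intro ε hε hε1
    obtain ⟨δ, hδ, hcδ⟩ := Metric.uniformContinuous_iff.1
      (CompactSpace.uniformContinuous_of_continuous hc) ε hε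
    obtain ⟨t, φ, hφ, hφ0, hφ1, hφδ⟩ := exists_finite_partition_of_unity_small (X := X) hδ
    have hbound := fun n => Wcost_le_of_partition hc (β := α' n) σ h₁ h₂ hφ hφ0 hφ1 hε hε1
      (fun x y => hM (x, y) (Set.mem_univ _)) fun i x x' y hx hx' => by
        have h := @hcδ (x, y) (x', y) (by simpa [Prod.dist_eq, hδ] using hφδ i x x' hx hx')
        exact ((le_abs_self _).trans_lt h).le
    have hsum : ∑ i, ∫ x, φ i x ∂α = 1 := by
      rw [← integral_finsetSum _ fun i _ => (hφ i).integrable_of_compactSpace]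
      simp only [hφ1, integral_const, probReal_univ, smul_eq_mul, mul_one]
    have hmin : Tendsto (fun n => ∑ i, min (∫ x, φ i x ∂α) (∫ x, φ i x ∂(α' n))) atTop
        (𝓝 1) := by
      rw [← hsum]
      refine tendsto_finsetSum _ fun i _ => ?_
      simpa using (tendsto_const_nhds (x := ∫ x, φ i x ∂α)).min (hα (φ i) (hφ i))
    have hlim := (((hmin.const_mul (1 - ε)).const_sub 1).const_mul (2 * M)).const_add
      (∫ p, c p.1 p.2 ∂σ + ε)
    rw [mul_one, sub_sub_cancel] at hlim
    exact le_of_tendsto_of_tendsto' hL hlim hbound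
  have hlim : Tendsto (fun ε : ℝ => ∫ p, c p.1 p.2 ∂σ + ε + 2 * M * ε) (𝓝[>] 0)
      (𝓝 (∫ p, c p.1 p.2 ∂σ)) := by
    have h : Continuous fun ε : ℝ => ∫ p, c p.1 p.2 ∂σ + ε + 2 * M * ε := by fun_prop
    simpa using (h.tendsto 0).mono_left nhdsWithin_le_nhds
  refine ge_of_tendsto hlim ?_
  filter_upwards [Ioo_mem_nhdsGT (zero_lt_one (α := ℝ))] with ε h
  exact hε ε h.1 h.2

end Coupling

/-- A weak limit of measures with marginals converging weakly has the limiting marginal. -/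
lemma map_eq_of_forall_tendsto_integral {Z W : Type*} [TopologicalSpace Z] [MeasurableSpace Z]
    [BorelSpace Z] [MetricSpace W] [MeasurableSpace W] [BorelSpace W]
    {μ' : ℕ → Measure Z} {μ : Measure Z} [IsFiniteMeasure μ] {κ : Measure W} [IsFiniteMeasure κ]
    (hμ : ∀ f : Z → ℝ, Continuous f →
      Tendsto (fun n => ∫ z, f z ∂(μ' n)) atTop (𝓝 (∫ z, f z ∂μ)))
    {g : Z → W} (hg : Continuous g)
    (hκ : ∀ f : W → ℝ, Continuous f →
      Tendsto (fun n => ∫ w, f w ∂((μ' n).map g)) atTop (𝓝 (∫ w, f w ∂κ))) :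
    μ.map g = κ := by
  refine ext_of_forall_integral_eq_of_IsFiniteMeasure fun f => ?_
  have hmap : ∀ m : Measure Z, ∫ w, f w ∂(m.map g) = ∫ z, f (g z) ∂m := fun m =>
    integral_map hg.measurable.aemeasurable f.continuous.measurable.aestronglyMeasurable
  have h := hκ f f.continuous
  simp only [hmap] at h
  rw [hmap]
  exact tendsto_nhds_unique (hμ _ (f.continuous.comp hg)) h

/-- stability of optimal transport plans: if `α_N → α` weakly, each `π_N` is
an optimal plan between `α_N` and `ν` for a continuous cost `c` on compact spaces, and
`π_N → π` weakly, then `π` is an optimal plan between `α` and `ν`, with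
`∫ c dπ = W_c(α, ν) = lim_N W_c(α_N, ν)`. -/
theorem optimal_plans_weak_stability
    {X Y : Type*} [MetricSpace X] [CompactSpace X] [MeasurableSpace X] [BorelSpace X]
    [MetricSpace Y] [CompactSpace Y] [MeasurableSpace Y] [BorelSpace Y]
    (c : X → Y → ℝ) (hc : Continuous fun p : X × Y => c p.1 p.2)
    (ν : Measure Y) [IsProbabilityMeasure ν]
    (α' : ℕ → Measure X) [∀ n, IsProbabilityMeasure (α' n)]
    (α : Measure X) [IsProbabilityMeasure α]
    (hαweak : ∀ f : X → ℝ, Continuous f →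
      Filter.Tendsto (fun n => ∫ x, f x ∂(α' n)) Filter.atTop (nhds (∫ x, f x ∂α)))
    (π' : ℕ → Measure (X × Y)) (hπ' : ∀ n, IsProbabilityMeasure (π' n))
    (hπ'fst : ∀ n, (π' n).map Prod.fst = α' n) (hπ'snd : ∀ n, (π' n).map Prod.snd = ν)
    (hπ'opt : ∀ n, ∫ p, c p.1 p.2 ∂(π' n) = Wcost c (α' n) ν)
    (π : Measure (X × Y))
    (hπweak : ∀ f : X × Y → ℝ, Continuous f →
      Filter.Tendsto (fun n => ∫ p, f p ∂(π' n)) Filter.atTop (nhds (∫ p, f p ∂π))) :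
    IsProbabilityMeasure π ∧ π.map Prod.fst = α ∧ π.map Prod.snd = ν ∧
    ∫ p, c p.1 p.2 ∂π = Wcost c α ν ∧
    Filter.Tendsto (fun n => Wcost c (α' n) ν) Filter.atTop (nhds (Wcost c α ν)) := by
  have hprob : IsProbabilityMeasure π := by
    have h := hπweak (fun _ => 1) continuous_const
    simp only [integral_const, probReal_univ, smul_eq_mul, mul_one] at h
    have h1 := tendsto_nhds_unique h tendsto_const_nhds
    exact ⟨by rwa [measureReal_def, ENNReal.toReal_eq_one_iff] at h1⟩
  have hfst : π.map Prod.fst = α :=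
    map_eq_of_forall_tendsto_integral hπweak continuous_fst (by simpa only [hπ'fst] using hαweak)
  have hsnd : π.map Prod.snd = ν :=
    map_eq_of_forall_tendsto_integral hπweak continuous_snd
      (by simpa only [hπ'snd] using fun f _ => tendsto_const_nhds)
  have hlim := hπweak _ hc
  simp only [hπ'opt] at hlim
  have hopt : ∫ p, c p.1 p.2 ∂π = Wcost c α ν := by
    refine le_antisymm (le_csInf ⟨_, π, hprob, hfst, hsnd, rfl⟩ ?_)
      (Wcost_le_integral hc π hfst hsnd)
    rintro _ ⟨σ, hσ, hσ₁, hσ₂, rfl⟩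
    exact limit_Wcost_le_integral hc hαweak σ hσ₁ hσ₂ hlim
  exact ⟨hprob, hfst, hsnd, hopt, hopt ▸ hlim⟩
end

section
/- Let X, Y ⊂ ℝⁿ be compact convex sets with nonempty interior, and let μ and ν be Borel probability measures on X and Y respectively, each absolutely continuous with respect to Lebesgue measure with densities bounded above and bounded away from zero. Then the functional F̂(β) = −H_ν(β) − W²(μ, β) has a unique maximizer β̂ over the set of Borel probability measures on Y, and the maximum value is finite. -/
open MeasureTheory Classical

/-- The quadratic transport cost `W²(μ, β)`: infimum of `∫ |x−y|²/2 dπ` over all probability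
measures `π` with first marginal `μ` and second marginal `β`. -/
noncomputable def W2 {n : ℕ} (μ β : Measure (EuclideanSpace ℝ (Fin n))) : ℝ :=
  sInf {r : ℝ | ∃ π : Measure (EuclideanSpace ℝ (Fin n) × EuclideanSpace ℝ (Fin n)),
    IsProbabilityMeasure π ∧ π.map Prod.fst = μ ∧ π.map Prod.snd = β ∧
    r = ∫ p, ‖p.1 - p.2‖ ^ 2 / 2 ∂π}

/-- The functional `F̂(β) = −H_ν(β) − W²(μ, β)`, where `H_ν(β) = ∫ ln(dβ/dν) dβ` is the
relative entropy, interpreted as `+∞` (so `F̂ = ⊥`) unless `β ≪ ν` with `ln(dβ/dν)`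
`β`-integrable. -/
noncomputable def Fhat {n : ℕ} (μ ν : Measure (EuclideanSpace ℝ (Fin n)))
    (β : Measure (EuclideanSpace ℝ (Fin n))) : EReal :=
  if β ≪ ν ∧ Integrable (fun y => Real.log ((β.rnDeriv ν y).toReal)) β
  then ((-(∫ y, Real.log ((β.rnDeriv ν y).toReal) ∂β) - W2 μ β : ℝ) : EReal)
  else ⊥

open InformationTheory Filter Topology
open scoped ENNReal NNReal

/-- Strict midpoint convexity of `klFun`, with a Hellinger-type remainder. -/
theorem klFun_midpoint {a b : ℝ} (ha : 0 ≤ a) (hb : 0 ≤ b) :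
    2 * klFun ((a + b) / 2) + (√a - √b) ^ 2 / 2 ≤ klFun a + klFun b := by
  have key : ∀ {x m : ℝ}, 0 ≤ x → 0 < m →
      2 * x - 2 * (√x * √m) ≤ x * Real.log x - x * Real.log m := by
    intro x m hx hm
    rcases hx.eq_or_lt with rfl | hx
    · simp
    have h := Real.log_le_sub_one_of_pos (x := √m / √x) (by positivity)
    rw [Real.log_div (by positivity) (by positivity), Real.log_sqrt hm.le,
      Real.log_sqrt hx.le] at h
    have h2 := mul_le_mul_of_nonneg_left h hx.le
    have h3 : x * (√m / √x - 1) = √x * √m - x := by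
      have h4 : x / √x = √x := Real.div_sqrt
      calc x * (√m / √x - 1) = x / √x * √m - x := by ring
        _ = _ := by rw [h4]
    rw [h3] at h2
    linarith
  rcases (add_nonneg ha hb).eq_or_lt with h | h
  · obtain rfl : a = 0 := by linarith
    obtain rfl : b = 0 := by linarith
    simp [two_mul]
  have hm : 0 < (a + b) / 2 := by positivity
  have h1 := key ha hm
  have h2 := key hb hm
  set m := (a + b) / 2 with hmdef
  have hab : a + b = 2 * m := by rw [hmdef]; ring
  have sa := Real.sq_sqrt ha
  have sb := Real.sq_sqrt hb
  have sm := Real.sq_sqrt hm.le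
  simp only [klFun]
  have h3 : 2 * (m * Real.log m) = a * Real.log m + b * Real.log m := by
    rw [← add_mul, hab]; ring
  nlinarith [sq_nonneg (√a + √b - 2 * √m)]

section Densities

variable {α : Type*} {mα : MeasurableSpace α} {ν β β₁ β₂ : Measure α}

/-- The midpoint of two measures. -/
noncomputable def midMeasure (β₁ β₂ : Measure α) : Measure α := (2⁻¹ : ℝ≥0) • (β₁ + β₂)

instance [IsProbabilityMeasure β₁] [IsProbabilityMeasure β₂] :
    IsProbabilityMeasure (midMeasure β₁ β₂) := by
  constructor
  simp only [midMeasure, Measure.smul_apply, Measure.add_apply, measure_univ,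
    ENNReal.smul_def, smul_eq_mul]
  rw [one_add_one_eq_two, ENNReal.coe_inv two_ne_zero]
  exact ENNReal.inv_mul_cancel two_ne_zero ENNReal.ofNat_ne_top

/-- The square root of the density of `β` with respect to `ν`. -/
noncomputable def sqrtDensity (β ν : Measure α) (x : α) : ℝ := √(β.rnDeriv ν x).toReal

theorem measurable_sqrtDensity (β ν : Measure α) : Measurable (sqrtDensity β ν) :=
  (Measure.measurable_rnDeriv β ν).ennreal_toReal.sqrt

theorem eLpNorm_two_sq (f : α → ℝ) :
    eLpNorm f 2 ν ^ 2 = ∫⁻ x, ENNReal.ofReal (f x ^ 2) ∂ν := by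
  have h := eLpNorm_nnreal_pow_eq_lintegral (f := f) (μ := ν) (p := 2) two_ne_zero
  simp only [NNReal.coe_ofNat, ENNReal.coe_ofNat, ENNReal.rpow_ofNat] at h
  rw [h]
  refine lintegral_congr fun x => ?_
  rw [← ofReal_norm, ← ENNReal.ofReal_pow (norm_nonneg _), Real.norm_eq_abs, sq_abs]

theorem eLpNorm_sqrtDensity [IsProbabilityMeasure β] [IsProbabilityMeasure ν] (h : β ≪ ν) :
    eLpNorm (sqrtDensity β ν) 2 ν = 1 := by
  have h1 : eLpNorm (sqrtDensity β ν) 2 ν ^ 2 = 1 := by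
    rw [eLpNorm_two_sq, ← measure_univ (μ := β), ← Measure.lintegral_rnDeriv h]
    refine lintegral_congr_ae ?_
    filter_upwards [Measure.rnDeriv_ne_top β ν] with x hx
    rw [sqrtDensity, Real.sq_sqrt ENNReal.toReal_nonneg, ENNReal.ofReal_toReal hx]
  exact le_antisymm (not_lt.1 fun h => (one_lt_pow' h two_ne_zero).ne' h1)
    (not_lt.1 fun h => (pow_lt_one' h two_ne_zero).ne h1)

theorem memLp_sqrtDensity [IsProbabilityMeasure β] [IsProbabilityMeasure ν] (h : β ≪ ν) :
    MemLp (sqrtDensity β ν) 2 ν :=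
  ⟨(measurable_sqrtDensity β ν).aestronglyMeasurable, by
    rw [eLpNorm_sqrtDensity h]; exact ENNReal.one_lt_top⟩

theorem klDiv_midMeasure [IsProbabilityMeasure β₁] [IsProbabilityMeasure β₂]
    [IsProbabilityMeasure ν] (h₁ : β₁ ≪ ν) (h₂ : β₂ ≪ ν) :
    2 * klDiv (midMeasure β₁ β₂) ν
      + eLpNorm (sqrtDensity β₁ ν - sqrtDensity β₂ ν) 2 ν ^ 2 / 2
      ≤ klDiv β₁ ν + klDiv β₂ ν := by
  have hm : midMeasure β₁ β₂ ≪ ν :=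
    Measure.AbsolutelyContinuous.smul_left (Measure.AbsolutelyContinuous.add_left h₁ h₂) _
  have hd : (midMeasure β₁ β₂).rnDeriv ν =ᵐ[ν]
      fun x => (2⁻¹ : ℝ≥0) • (β₁.rnDeriv ν x + β₂.rnDeriv ν x) := by
    filter_upwards [Measure.rnDeriv_smul_left' (β₁ + β₂) ν 2⁻¹, Measure.rnDeriv_add' β₁ β₂ ν]
      with x hx hx'
    rw [midMeasure, hx, Pi.smul_apply, hx', Pi.add_apply]
  have e1 := (Measure.measurable_rnDeriv β₁ ν).ennreal_toReal
  have e3 := (Measure.measurable_rnDeriv (midMeasure β₁ β₂) ν).ennreal_toReal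
  have m1 : Measurable fun x => ENNReal.ofReal (klFun (β₁.rnDeriv ν x).toReal) :=
    (measurable_klFun.comp e1).ennreal_ofReal
  have m3 : Measurable fun x => ENNReal.ofReal (klFun ((midMeasure β₁ β₂).rnDeriv ν x).toReal) :=
    (measurable_klFun.comp e3).ennreal_ofReal
  have ms := ((measurable_sqrtDensity β₁ ν).sub (measurable_sqrtDensity β₂ ν)).pow_const 2
  rw [klDiv_eq_lintegral_klFun_of_ac hm, klDiv_eq_lintegral_klFun_of_ac h₁,
    klDiv_eq_lintegral_klFun_of_ac h₂, eLpNorm_two_sq, ENNReal.div_eq_inv_mul,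
    ← lintegral_const_mul _ m3, ← lintegral_const_mul _ ms.ennreal_ofReal,
    ← lintegral_add_left (m3.const_mul 2), ← lintegral_add_left m1]
  refine lintegral_mono_ae ?_
  filter_upwards [hd, Measure.rnDeriv_ne_top β₁ ν, Measure.rnDeriv_ne_top β₂ ν] with x hx t1 t2
  have hx' : ((midMeasure β₁ β₂).rnDeriv ν x).toReal
      = ((β₁.rnDeriv ν x).toReal + (β₂.rnDeriv ν x).toReal) / 2 := by
    rw [hx, ENNReal.smul_def, smul_eq_mul, ENNReal.toReal_mul, ENNReal.toReal_add t1 t2]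
    simp; ring
  have p1 : 0 ≤ (β₁.rnDeriv ν x).toReal := ENNReal.toReal_nonneg
  have p2 : 0 ≤ (β₂.rnDeriv ν x).toReal := ENNReal.toReal_nonneg
  have key := klFun_midpoint p1 p2
  rw [hx']
  have i2 : (2 : ℝ≥0∞)⁻¹ = ENNReal.ofReal 2⁻¹ := by
    rw [ENNReal.ofReal_inv_of_pos two_pos]; simp
  have i3 : (2 : ℝ≥0∞) = ENNReal.ofReal 2 := by simp
  rw [i2, i3, ← ENNReal.ofReal_mul (by norm_num), ← ENNReal.ofReal_mul (by norm_num),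
    ← ENNReal.ofReal_add, ← ENNReal.ofReal_add (klFun_nonneg p1) (klFun_nonneg p2)]
  · refine ENNReal.ofReal_le_ofReal ?_
    simp only [Pi.sub_apply, sqrtDensity]
    linarith
  · exact mul_nonneg zero_le_two (klFun_nonneg (by positivity))
  · positivity

theorem eq_of_sqrtDensity_ae_eq [IsProbabilityMeasure β₁] [IsProbabilityMeasure β₂]
    [IsProbabilityMeasure ν] (h₁ : β₁ ≪ ν) (h₂ : β₂ ≪ ν)
    (h : sqrtDensity β₁ ν =ᵐ[ν] sqrtDensity β₂ ν) : β₁ = β₂ := by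
  rw [← Measure.withDensity_rnDeriv_eq β₁ ν h₁, ← Measure.withDensity_rnDeriv_eq β₂ ν h₂]
  refine withDensity_congr_ae ?_
  filter_upwards [h, Measure.rnDeriv_ne_top β₁ ν, Measure.rnDeriv_ne_top β₂ ν] with x hx t1 t2
  rw [sqrtDensity, sqrtDensity, Real.sqrt_inj ENNReal.toReal_nonneg ENNReal.toReal_nonneg] at hx
  exact (ENNReal.toReal_eq_toReal_iff' t1 t2).1 hx

theorem klDiv_add_const_le_liminf [IsProbabilityMeasure ν] [IsProbabilityMeasure β]
    {b : ℕ → Measure α} [∀ k, IsProbabilityMeasure (b k)] (hb : ∀ k, b k ≪ ν) (h : β ≪ ν)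
    (hlim : ∀ᵐ x ∂ν, Tendsto (fun k => (b k).rnDeriv ν x) atTop (𝓝 (β.rnDeriv ν x)))
    (w : ℝ≥0∞) :
    klDiv β ν + w ≤ liminf (fun k => klDiv (b k) ν + w) atTop := by
  have hw : ∀ {γ : Measure α} [IsProbabilityMeasure γ], γ ≪ ν → klDiv γ ν + w
      = ∫⁻ x, ENNReal.ofReal (klFun (γ.rnDeriv ν x).toReal) + w ∂ν := by
    intro γ _ hγ
    rw [lintegral_add_right _ measurable_const, klDiv_eq_lintegral_klFun_of_ac hγ]
    simp
  rw [hw h, funext fun k => hw (hb k)]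
  refine le_trans (lintegral_mono_ae ?_) (lintegral_liminf_le fun k =>
    (measurable_klFun.comp
      (Measure.measurable_rnDeriv (b k) ν).ennreal_toReal).ennreal_ofReal.add_const w)
  filter_upwards [hlim, Measure.rnDeriv_ne_top β ν] with x hx hx'
  have := ((ENNReal.continuous_ofReal.comp continuous_klFun).tendsto _).comp
    ((ENNReal.tendsto_toReal hx').comp hx)
  exact (this.add_const w).liminf_eq.ge

/-- The common part of two measures, defined through their densities with respect to `ν`. -/
noncomputable def commonPart (β₁ β₂ ν : Measure α) : Measure α :=
  ν.withDensity fun x => min (β₁.rnDeriv ν x) (β₂.rnDeriv ν x)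

theorem commonPart_le_left (β₁ β₂ ν : Measure α) : commonPart β₁ β₂ ν ≤ β₁ :=
  (withDensity_mono (ae_of_all _ fun _ => min_le_left _ _)).trans
    (Measure.withDensity_rnDeriv_le β₁ ν)

theorem commonPart_le_right (β₁ β₂ ν : Measure α) : commonPart β₁ β₂ ν ≤ β₂ :=
  (withDensity_mono (ae_of_all _ fun _ => min_le_right _ _)).trans
    (Measure.withDensity_rnDeriv_le β₂ ν)

theorem tendsto_commonPart_univ [IsProbabilityMeasure ν] [IsProbabilityMeasure β]
    {b : ℕ → Measure α} (h : β ≪ ν)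
    (hlim : ∀ᵐ x ∂ν, Tendsto (fun k => (b k).rnDeriv ν x) atTop (𝓝 (β.rnDeriv ν x))) :
    Tendsto (fun k => (commonPart β (b k) ν).real Set.univ) atTop (𝓝 1) := by
  have hint : ∫⁻ x, β.rnDeriv ν x ∂ν = 1 := by rw [Measure.lintegral_rnDeriv h, measure_univ]
  have key : Tendsto (fun k => ∫⁻ x, min (β.rnDeriv ν x) ((b k).rnDeriv ν x) ∂ν) atTop
      (𝓝 (∫⁻ x, β.rnDeriv ν x ∂ν)) := by
    refine tendsto_lintegral_of_dominated_convergence (β.rnDeriv ν)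
      (fun k => (Measure.measurable_rnDeriv β ν).min (Measure.measurable_rnDeriv (b k) ν))
      (fun k => ae_of_all _ fun x => min_le_left _ _) (by rw [hint]; exact ENNReal.one_ne_top) ?_
    filter_upwards [hlim] with x hx
    simpa using (tendsto_const_nhds (x := β.rnDeriv ν x)).min hx
  rw [hint] at key
  have := (ENNReal.tendsto_toReal ENNReal.one_ne_top).comp key
  simpa [Function.comp_def, commonPart, measureReal_def, withDensity_apply] using this

end Densities

section Transport

variable {n : ℕ} {X Y : Set (EuclideanSpace ℝ (Fin n))}
  {μ β β₁ β₂ : Measure (EuclideanSpace ℝ (Fin n))}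
  {π : Measure (EuclideanSpace ℝ (Fin n) × EuclideanSpace ℝ (Fin n))}

theorem exists_cost_bound (hX : IsCompact X) (hY : IsCompact Y) :
    ∃ C : ℝ, ∀ p ∈ X ×ˢ Y, ‖p.1 - p.2‖ ^ 2 / 2 ≤ C := by
  obtain ⟨C, hC⟩ := (hX.prod hY).exists_bound_of_continuousOn
    (f := fun p => ‖p.1 - p.2‖ ^ 2 / 2) (by fun_prop)
  exact ⟨C, fun p hp => (Real.le_norm_self _).trans (hC p hp)⟩

theorem bddBelow_costs (μ β : Measure (EuclideanSpace ℝ (Fin n))) :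
    BddBelow {r : ℝ | ∃ π : Measure (EuclideanSpace ℝ (Fin n) × EuclideanSpace ℝ (Fin n)),
      IsProbabilityMeasure π ∧ π.map Prod.fst = μ ∧ π.map Prod.snd = β ∧
      r = ∫ p, ‖p.1 - p.2‖ ^ 2 / 2 ∂π} := by
  refine ⟨0, ?_⟩
  rintro r ⟨π, -, -, -, rfl⟩
  exact integral_nonneg fun p => by positivity

theorem W2_nonneg (μ β : Measure (EuclideanSpace ℝ (Fin n))) : 0 ≤ W2 μ β := by
  refine Real.sInf_nonneg ?_
  rintro r ⟨π, -, -, -, rfl⟩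
  exact integral_nonneg fun p => by positivity

theorem W2_le [IsProbabilityMeasure π] (h₁ : π.map Prod.fst = μ) (h₂ : π.map Prod.snd = β) :
    W2 μ β ≤ ∫ p, ‖p.1 - p.2‖ ^ 2 / 2 ∂π :=
  csInf_le (bddBelow_costs μ β) ⟨π, inferInstance, h₁, h₂, rfl⟩

theorem exists_coupling_lt [IsProbabilityMeasure μ] [IsProbabilityMeasure β] {ε : ℝ}
    (hε : 0 < ε) :
    ∃ π : Measure (EuclideanSpace ℝ (Fin n) × EuclideanSpace ℝ (Fin n)),
      IsProbabilityMeasure π ∧ π.map Prod.fst = μ ∧ π.map Prod.snd = β ∧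
      ∫ p, ‖p.1 - p.2‖ ^ 2 / 2 ∂π < W2 μ β + ε := by
  have hne : {r : ℝ | ∃ π : Measure (EuclideanSpace ℝ (Fin n) × EuclideanSpace ℝ (Fin n)),
      IsProbabilityMeasure π ∧ π.map Prod.fst = μ ∧ π.map Prod.snd = β ∧
      r = ∫ p, ‖p.1 - p.2‖ ^ 2 / 2 ∂π}.Nonempty :=
    ⟨_, μ.prod β, inferInstance, by simp, by simp, rfl⟩
  obtain ⟨r, ⟨π, h0, h1, h2, rfl⟩, hr⟩ :=
    exists_lt_of_csInf_lt hne (lt_add_of_pos_right (W2 μ β) hε)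
  exact ⟨π, h0, h1, h2, hr⟩

theorem ae_cost_le {C : ℝ} (hC : ∀ p ∈ X ×ˢ Y, ‖p.1 - p.2‖ ^ 2 / 2 ≤ C)
    (hX : ∀ᵐ x ∂π.map Prod.fst, x ∈ X) (hY : ∀ᵐ y ∂π.map Prod.snd, y ∈ Y) :
    ∀ᵐ p ∂π, ‖p.1 - p.2‖ ^ 2 / 2 ≤ C := by
  filter_upwards [ae_of_ae_map measurable_fst.aemeasurable hX,
    ae_of_ae_map measurable_snd.aemeasurable hY] with p h1 h2
  exact hC p ⟨h1, h2⟩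

theorem integrable_cost [IsFiniteMeasure π] {C : ℝ} (h : ∀ᵐ p ∂π, ‖p.1 - p.2‖ ^ 2 / 2 ≤ C) :
    Integrable (fun p => ‖p.1 - p.2‖ ^ 2 / 2) π := by
  refine Integrable.of_bound (by fun_prop : Continuous _).aestronglyMeasurable C ?_
  filter_upwards [h] with p hp
  rwa [Real.norm_of_nonneg (by positivity)]

theorem W2_midMeasure (hXc : IsCompact X) (hYc : IsCompact Y) [IsProbabilityMeasure μ]
    [IsProbabilityMeasure β₁] [IsProbabilityMeasure β₂] (hμ : ∀ᵐ x ∂μ, x ∈ X)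
    (h₁ : ∀ᵐ x ∂β₁, x ∈ Y) (h₂ : ∀ᵐ x ∂β₂, x ∈ Y) :
    2 * W2 μ (midMeasure β₁ β₂) ≤ W2 μ β₁ + W2 μ β₂ := by
  obtain ⟨C, hC⟩ := exists_cost_bound hXc hYc
  refine le_of_forall_pos_le_add fun ε hε => ?_
  obtain ⟨π₁, i1, f1, s1, c1⟩ := exists_coupling_lt (μ := μ) (β := β₁) (half_pos hε)
  obtain ⟨π₂, i2, f2, s2, c2⟩ := exists_coupling_lt (μ := μ) (β := β₂) (half_pos hε)
  have int1 := integrable_cost (π := π₁) (ae_cost_le hC (by rwa [f1]) (by rwa [s1]))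
  have int2 := integrable_cost (π := π₂) (ae_cost_le hC (by rwa [f2]) (by rwa [s2]))
  have key := W2_le (π := midMeasure π₁ π₂) (μ := μ) (β := midMeasure β₁ β₂) (by
      rw [midMeasure, Measure.map_smul, Measure.map_add _ _ measurable_fst, f1, f2, ← two_smul ℝ≥0,
        smul_smul]
      simp) (by
      rw [midMeasure, Measure.map_smul, Measure.map_add _ _ measurable_snd, s1, s2, midMeasure])
  rw [show midMeasure π₁ π₂ = (2⁻¹ : ℝ≥0) • (π₁ + π₂) from rfl, integral_smul_nnreal_measure, integral_add_measure int1 int2] at key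
  rw [NNReal.smul_def, smul_eq_mul, NNReal.coe_inv, NNReal.coe_ofNat] at key
  linarith

/-- The transport cost varies at most linearly with the mass not shared by the two targets. -/
theorem W2_le_add_of_le {C : ℝ} (hC : ∀ p ∈ X ×ˢ Y, ‖p.1 - p.2‖ ^ 2 / 2 ≤ C)
    [IsProbabilityMeasure μ] [IsProbabilityMeasure β₁] [IsProbabilityMeasure β₂]
    (hμ : ∀ᵐ x ∂μ, x ∈ X) (h₁ : ∀ᵐ x ∂β₁, x ∈ Y) (h₂ : ∀ᵐ x ∂β₂, x ∈ Y)
    {m : Measure (EuclideanSpace ℝ (Fin n))} (m₁ : m ≤ β₁) (m₂ : m ≤ β₂) :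
    W2 μ β₁ ≤ W2 μ β₂ + C * (1 - m.real Set.univ) := by
  have : IsFiniteMeasure m := isFiniteMeasure_of_le β₁ m₁
  have : m.HaveLebesgueDecomposition β₂ := Measure.haveLebesgueDecomposition_of_sigmaFinite m β₂
  have hm : β₂.withDensity (m.rnDeriv β₂) = m :=
    Measure.withDensity_rnDeriv_eq m β₂ (Measure.absolutelyContinuous_of_le m₂)
  refine le_of_forall_pos_le_add fun ε hε => ?_
  obtain ⟨π, i, f, s, c⟩ := exists_coupling_lt (μ := μ) (β := β₂) hε
  have int := integrable_cost (π := π) (ae_cost_le hC (by rwa [f]) (by rwa [s]))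
  set h := m.rnDeriv β₂
  have hh : Measurable h := Measure.measurable_rnDeriv _ _
  set ρ := π.withDensity (fun p => h p.2) with hρ
  have hρπ : ρ ≤ π := by
    have : ∀ᵐ y ∂π.map Prod.snd, h y ≤ 1 := by
      rw [s]; exact Measure.rnDeriv_le_one_of_le m₂
    calc ρ ≤ π.withDensity 1 :=
          withDensity_mono (ae_of_ae_map measurable_snd.aemeasurable this)
      _ = π := withDensity_one
  have : IsFiniteMeasure ρ := isFiniteMeasure_of_le π hρπ
  have hρs : ρ.map Prod.snd = m := by
    ext t ht
    rw [← hm, Measure.map_apply measurable_snd ht, withDensity_apply _ (measurable_snd ht),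
      withDensity_apply _ ht, ← s, setLIntegral_map ht hh measurable_snd]
  set κ := ρ.map Prod.fst with hκ
  have hκμ : κ ≤ μ := by rw [← f]; exact Measure.map_mono hρπ measurable_fst
  have hκm : κ Set.univ = m Set.univ := by
    rw [← hρs, hκ, Measure.map_apply measurable_fst .univ, Measure.map_apply measurable_snd .univ]
    simp
  have : IsFiniteMeasure κ := isFiniteMeasure_of_le μ hκμ
  have hμκ : (μ - κ) Set.univ = 1 - m Set.univ := by
    rw [Measure.sub_apply .univ hκμ, hκm, measure_univ]
  have hβm : (β₁ - m) Set.univ = 1 - m Set.univ := by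
    rw [Measure.sub_apply .univ m₁, measure_univ]
  have hm1 : m Set.univ ≤ 1 := by simpa using m₁ Set.univ
  set t := 1 - m Set.univ with ht
  have htop : t ≠ ∞ := ne_top_of_le_ne_top ENNReal.one_ne_top tsub_le_self
  have hI1 : t⁻¹ • t • (μ - κ) = μ - κ := by
    by_cases h0 : t = 0
    · rw [Measure.measure_univ_eq_zero.1 (hμκ.trans h0)]; simp
    · rw [smul_smul, ENNReal.inv_mul_cancel h0 htop, one_smul]
  have hI2 : t⁻¹ • t • (β₁ - m) = β₁ - m := by
    by_cases h0 : t = 0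
    · rw [Measure.measure_univ_eq_zero.1 (hβm.trans h0)]; simp
    · rw [smul_smul, ENNReal.inv_mul_cancel h0 htop, one_smul]
  set τ := t⁻¹ • (μ - κ).prod (β₁ - m) with hτ
  have hτf : τ.map Prod.fst = μ - κ := by
    rw [hτ, Measure.map_smul, Measure.map_fst_prod, hβm, hI1]
  have hτs : τ.map Prod.snd = β₁ - m := by
    rw [hτ, Measure.map_smul, Measure.map_snd_prod, hμκ, hI2]
  have hτu : τ Set.univ = t := by
    rw [← hμκ, ← hτf, Measure.map_apply measurable_fst .univ, Set.preimage_univ]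
  have : IsFiniteMeasure τ := ⟨by rw [hτu]; exact htop.lt_top⟩
  have hfst : (ρ + τ).map Prod.fst = μ := by
    rw [Measure.map_add _ _ measurable_fst, hτf, ← hκ, add_comm, Measure.sub_add_cancel_of_le hκμ]
  have hsnd : (ρ + τ).map Prod.snd = β₁ := by
    rw [Measure.map_add _ _ measurable_snd, hτs, hρs, add_comm, Measure.sub_add_cancel_of_le m₁]
  have : IsProbabilityMeasure (ρ + τ) := by
    refine ⟨?_⟩
    rw [← measure_univ (μ := μ), ← hfst, Measure.map_apply measurable_fst .univ, Set.preimage_univ]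
  have hτC : ∀ᵐ p ∂τ, ‖p.1 - p.2‖ ^ 2 / 2 ≤ C := by
    refine ae_cost_le hC ?_ ?_
    · rw [hτf]; exact ae_mono Measure.sub_le hμ
    · rw [hτs]; exact ae_mono Measure.sub_le h₁
  have key := W2_le hfst hsnd
  rw [integral_add_measure (int.mono_measure hρπ) (integrable_cost hτC)] at key
  have b1 : ∫ p, ‖p.1 - p.2‖ ^ 2 / 2 ∂ρ ≤ ∫ p, ‖p.1 - p.2‖ ^ 2 / 2 ∂π :=
    integral_mono_measure hρπ (ae_of_all _ fun p => by positivity) int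
  have b2 : ∫ p, ‖p.1 - p.2‖ ^ 2 / 2 ∂τ ≤ C * (1 - m.real Set.univ) := by
    have := integral_mono_ae (integrable_cost hτC) (integrable_const C) hτC
    rw [integral_const, smul_eq_mul, measureReal_def, hτu, ht,
      ENNReal.toReal_sub_of_le hm1 ENNReal.one_ne_top, mul_comm] at this
    simpa [measureReal_def] using this
  linarith

end Transport

section Energy

variable {n : ℕ} {X Y : Set (EuclideanSpace ℝ (Fin n))}
  {μ ν β β₁ β₂ : Measure (EuclideanSpace ℝ (Fin n))}

/-- The negative of `Fhat`, with values in `[0, ∞]`. -/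
noncomputable def energy (μ ν β : Measure (EuclideanSpace ℝ (Fin n))) : ℝ≥0∞ :=
  klDiv β ν + ENNReal.ofReal (W2 μ β)

theorem energy_ne_top_iff : energy μ ν β ≠ ∞ ↔ klDiv β ν ≠ ∞ := by
  simp [energy]

theorem ac_of_energy_ne_top (h : energy μ ν β ≠ ∞) : β ≪ ν :=
  (klDiv_ne_top_iff.1 (energy_ne_top_iff.1 h)).1

theorem Fhat_eq_neg_energy [IsProbabilityMeasure ν] [IsProbabilityMeasure β] :
    Fhat μ ν β = -(energy μ ν β : EReal) := by
  by_cases h : klDiv β ν = ∞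
  · have h' : ¬ (β ≪ ν ∧ Integrable (fun y => Real.log ((β.rnDeriv ν y).toReal)) β) :=
      fun h' => klDiv_ne_top_iff.2 h' h
    rw [Fhat, if_neg h', energy, h]
    simp
  · have h' : β ≪ ν ∧ Integrable (fun y => Real.log ((β.rnDeriv ν y).toReal)) β :=
      klDiv_ne_top_iff.1 h
    have hk := toReal_klDiv_of_measure_eq h'.1 (by simp)
    have he : energy μ ν β = ENNReal.ofReal ((klDiv β ν).toReal + W2 μ β) := by
      rw [energy, ENNReal.ofReal_add ENNReal.toReal_nonneg (W2_nonneg _ _),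
        ENNReal.ofReal_toReal h]
    rw [Fhat, if_pos h', he, EReal.coe_ennreal_ofReal, max_eq_left
      (add_nonneg ENNReal.toReal_nonneg (W2_nonneg _ _)), hk, ← EReal.coe_neg, neg_add]
    rfl

theorem energy_midMeasure (hXc : IsCompact X) (hYc : IsCompact Y) [IsProbabilityMeasure μ]
    [IsProbabilityMeasure ν] [IsProbabilityMeasure β₁] [IsProbabilityMeasure β₂]
    (hμ : ∀ᵐ x ∂μ, x ∈ X) (hν : ∀ᵐ x ∂ν, x ∈ Y) (h₁ : β₁ ≪ ν) (h₂ : β₂ ≪ ν) :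
    2 * energy μ ν (midMeasure β₁ β₂)
      + eLpNorm (sqrtDensity β₁ ν - sqrtDensity β₂ ν) 2 ν ^ 2 / 2
      ≤ energy μ ν β₁ + energy μ ν β₂ := by
  have hW := ENNReal.ofReal_le_ofReal
    (W2_midMeasure hXc hYc hμ (h₁.ae_le hν) (h₂.ae_le hν))
  rw [ENNReal.ofReal_mul zero_le_two, ENNReal.ofReal_add (W2_nonneg _ _) (W2_nonneg _ _),
    ENNReal.ofReal_ofNat] at hW
  calc _ = 2 * klDiv (midMeasure β₁ β₂) ν
        + eLpNorm (sqrtDensity β₁ ν - sqrtDensity β₂ ν) 2 ν ^ 2 / 2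
        + 2 * ENNReal.ofReal (W2 μ (midMeasure β₁ β₂)) := by rw [energy]; ring
    _ ≤ (klDiv β₁ ν + klDiv β₂ ν) + (ENNReal.ofReal (W2 μ β₁) + ENNReal.ofReal (W2 μ β₂)) :=
        add_le_add (klDiv_midMeasure h₁ h₂) hW
    _ = _ := by rw [energy, energy]; ring

theorem energy_le_of_tendsto (hXc : IsCompact X) (hYc : IsCompact Y) [IsProbabilityMeasure μ]
    [IsProbabilityMeasure ν] [IsProbabilityMeasure β]
    {b : ℕ → Measure (EuclideanSpace ℝ (Fin n))} [∀ k, IsProbabilityMeasure (b k)]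
    (hμ : ∀ᵐ x ∂μ, x ∈ X) (hν : ∀ᵐ x ∂ν, x ∈ Y) (hb : ∀ k, b k ≪ ν) (h : β ≪ ν)
    (hlim : ∀ᵐ x ∂ν, Tendsto (fun k => (b k).rnDeriv ν x) atTop (𝓝 (β.rnDeriv ν x)))
    {I : ℝ≥0∞} (hI : Tendsto (fun k => energy μ ν (b k)) atTop (𝓝 I)) :
    energy μ ν β ≤ I := by
  obtain ⟨C, hC⟩ := exists_cost_bound hXc hYc
  set δ : ℕ → ℝ := fun k => C * (1 - (commonPart β (b k) ν).real Set.univ)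
  have hδ0 : Tendsto (fun k => ENNReal.ofReal (δ k)) atTop (𝓝 0) := by
    have := ENNReal.tendsto_ofReal
      (((tendsto_commonPart_univ h hlim).const_sub 1).const_mul C)
    simpa using this
  refine (klDiv_add_const_le_liminf hb h hlim _).trans ?_
  have hle : ∀ k, klDiv (b k) ν + ENNReal.ofReal (W2 μ β)
      ≤ energy μ ν (b k) + ENNReal.ofReal (δ k) := by
    intro k
    rw [energy, add_assoc]
    refine add_le_add_right ((ENNReal.ofReal_le_ofReal (W2_le_add_of_le hC hμ (h.ae_le hν)
      ((hb k).ae_le hν) (commonPart_le_left β (b k) ν)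
      (commonPart_le_right β (b k) ν))).trans ENNReal.ofReal_add_le) _
  refine (liminf_le_liminf (Eventually.of_forall hle)).trans ?_
  have := (hI.add hδ0).liminf_eq
  rw [add_zero] at this
  exact this.le

theorem exists_energy_minimizer (hXc : IsCompact X) (hYc : IsCompact Y)
    [IsProbabilityMeasure μ] [IsProbabilityMeasure ν]
    (hμ : ∀ᵐ x ∂μ, x ∈ X) (hν : ∀ᵐ x ∂ν, x ∈ Y) :
    ∃ β : Measure (EuclideanSpace ℝ (Fin n)), IsProbabilityMeasure β ∧ energy μ ν β ≠ ∞ ∧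
      ∀ β' : Measure (EuclideanSpace ℝ (Fin n)), IsProbabilityMeasure β' →
        energy μ ν β ≤ energy μ ν β' := by
  set S := energy μ ν '' {β | IsProbabilityMeasure β}
  have hνtop : energy μ ν ν ≠ ∞ := by rw [energy_ne_top_iff, klDiv_self]; exact ENNReal.zero_ne_top
  set I := sInf S
  have hIle : ∀ β : Measure (EuclideanSpace ℝ (Fin n)), IsProbabilityMeasure β →
      I ≤ energy μ ν β := fun β hβ => sInf_le ⟨β, hβ, rfl⟩
  have hItop : I ≠ ∞ := ne_top_of_le_ne_top hνtop (hIle ν inferInstance)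
  have hex : ∀ k : ℕ, ∃ β : Measure (EuclideanSpace ℝ (Fin n)), IsProbabilityMeasure β ∧
      energy μ ν β < I + ENNReal.ofReal (1 / ((k : ℝ) + 1)) := by
    intro k
    have : I < I + ENNReal.ofReal (1 / ((k : ℝ) + 1)) :=
      ENNReal.lt_add_right hItop (ENNReal.ofReal_pos.2 (by positivity)).ne'
    obtain ⟨_, ⟨β, hβ, rfl⟩, hlt⟩ := sInf_lt_iff.1 this
    exact ⟨β, hβ, hlt⟩
  choose b hbp hblt using hex
  have hbac : ∀ k, b k ≪ ν := fun k => ac_of_energy_ne_top (hblt k).ne_top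
  have hbI : Tendsto (fun k => energy μ ν (b k)) atTop (𝓝 I) := by
    refine tendsto_of_tendsto_of_tendsto_of_le_of_le tendsto_const_nhds ?_
      (fun k => hIle _ (hbp k)) (fun k => (hblt k).le)
    have := (ENNReal.tendsto_ofReal tendsto_one_div_add_atTop_nhds_zero_nat).const_add I
    simpa using this
  set u : ℕ → Lp ℝ 2 ν := fun k => (memLp_sqrtDensity (hbac k)).toLp with hu
  have hcau : CauchySeq u := by
    refine cauchySeq_of_le_tendsto_0 (fun N : ℕ => √(4 * (1 / ((N : ℝ) + 1)))) ?_ ?_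
    · intro j k N hj hk
      have e1 : ∀ {i}, N ≤ i →
          energy μ ν (b i) ≤ I + ENNReal.ofReal (1 / ((N : ℝ) + 1)) := by
        intro i hi
        refine (hblt i).le.trans (add_le_add_right (ENNReal.ofReal_le_ofReal ?_) _)
        gcongr
      have key := energy_midMeasure hXc hYc hμ hν (hbac j) (hbac k)
      have h2 : 2 * I + eLpNorm (sqrtDensity (b j) ν - sqrtDensity (b k) ν) 2 ν ^ 2 / 2
          ≤ 2 * I + ENNReal.ofReal (2 * (1 / ((N : ℝ) + 1))) := by
        calc _ ≤ _ := add_le_add_left (mul_le_mul_right (hIle _ inferInstance) 2) _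
          _ ≤ _ := key
          _ ≤ _ := add_le_add (e1 hj) (e1 hk)
          _ = _ := by
            rw [ENNReal.ofReal_mul zero_le_two, ENNReal.ofReal_ofNat]; ring
      have h3 := (ENNReal.add_le_add_iff_left
        (ENNReal.mul_ne_top ENNReal.ofNat_ne_top hItop)).1 h2
      rw [← Lp.edist_toLp_toLp _ _ (memLp_sqrtDensity (hbac j)) (memLp_sqrtDensity (hbac k)),
        edist_dist, ← ENNReal.ofReal_pow dist_nonneg] at h3
      change ENNReal.ofReal (dist (u j) (u k) ^ 2) / 2 ≤ _ at h3
      generalize dist (u j) (u k) = d at h3 ⊢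
      rw [← ENNReal.ofReal_ofNat 2, ← ENNReal.ofReal_div_of_pos two_pos, ENNReal.ofReal_le_ofReal_iff (by positivity)] at h3
      exact Real.le_sqrt_of_sq_le (by linarith)
    · have := (tendsto_one_div_add_atTop_nhds_zero_nat (𝕜 := ℝ)).const_mul 4
      simpa using this.sqrt
  obtain ⟨v, hv⟩ := cauchySeq_tendsto_of_complete hcau
  have hvnorm : ‖v‖ = 1 := by
    have h1 : ∀ k, ‖u k‖ = 1 := fun k => by
      rw [hu, Lp.norm_toLp, eLpNorm_sqrtDensity (hbac k), ENNReal.toReal_one]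
    exact tendsto_nhds_unique (hv.norm) (by simp [h1])
  obtain ⟨ns, hns, hae⟩ := (tendstoInMeasure_of_tendsto_Lp hv).exists_seq_tendsto_ae
  have hvm : Measurable v := (Lp.stronglyMeasurable v).measurable
  set g : EuclideanSpace ℝ (Fin n) → ℝ≥0∞ := fun x => ENNReal.ofReal (v x ^ 2) with hg
  have hgm : Measurable g := (hvm.pow_const 2).ennreal_ofReal
  set β := ν.withDensity g with hβ
  have hβp : IsProbabilityMeasure β := by
    refine ⟨?_⟩
    rw [hβ, withDensity_apply _ .univ, Measure.restrict_univ, hg, ← eLpNorm_two_sq]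
    rw [Lp.norm_def] at hvnorm
    rw [(ENNReal.toReal_eq_one_iff _).1 hvnorm, one_pow]
  have hβac : β ≪ ν := withDensity_absolutelyContinuous _ _
  have hlim : ∀ᵐ x ∂ν,
      Tendsto (fun k => (b (ns k)).rnDeriv ν x) atTop (𝓝 (β.rnDeriv ν x)) := by
    have c1 : ∀ᵐ x ∂ν, ∀ k, u k x = sqrtDensity (b k) ν x :=
      ae_all_iff.2 fun k => (memLp_sqrtDensity (hbac k)).coeFn_toLp
    have c2 : ∀ᵐ x ∂ν, ∀ k, (b k).rnDeriv ν x ≠ ∞ :=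
      ae_all_iff.2 fun k => Measure.rnDeriv_ne_top (b k) ν
    filter_upwards [hae, c1, c2, Measure.rnDeriv_withDensity ν hgm] with x hx h1 h2 h3
    rw [hβ, h3]
    refine (ENNReal.tendsto_ofReal (hx.pow 2)).congr fun k => ?_
    rw [h1, sqrtDensity, Real.sq_sqrt ENNReal.toReal_nonneg, ENNReal.ofReal_toReal (h2 _)]
  have hmin : energy μ ν β ≤ I := energy_le_of_tendsto (b := fun k => b (ns k)) hXc hYc hμ hν
    (fun k => hbac _) hβac hlim (hbI.comp hns.tendsto_atTop)
  exact ⟨β, hβp, ne_top_of_le_ne_top hItop hmin, fun β' h' => hmin.trans (hIle β' h')⟩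

theorem energy_minimizer_unique (hXc : IsCompact X) (hYc : IsCompact Y)
    [IsProbabilityMeasure μ] [IsProbabilityMeasure ν] [IsProbabilityMeasure β₁]
    [IsProbabilityMeasure β₂] (hμ : ∀ᵐ x ∂μ, x ∈ X) (hν : ∀ᵐ x ∂ν, x ∈ Y)
    (htop : energy μ ν β₁ ≠ ∞) (heq : energy μ ν β₂ = energy μ ν β₁)
    (hmin : energy μ ν β₁ ≤ energy μ ν (midMeasure β₁ β₂)) : β₁ = β₂ := by
  have h₁ := ac_of_energy_ne_top htop
  have h₂ : β₂ ≪ ν := ac_of_energy_ne_top (heq ▸ htop)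
  have key := energy_midMeasure hXc hYc hμ hν h₁ h₂
  have h2 : 2 * energy μ ν β₁ + eLpNorm (sqrtDensity β₁ ν - sqrtDensity β₂ ν) 2 ν ^ 2 / 2
      ≤ 2 * energy μ ν β₁ + 0 := by
    calc _ ≤ _ := add_le_add_left (mul_le_mul_right hmin 2) _
      _ ≤ _ := key
      _ = _ := by rw [heq]; ring
  have h3 := (ENNReal.add_le_add_iff_left
    (ENNReal.mul_ne_top ENNReal.ofNat_ne_top htop)).1 h2
  have h4 : eLpNorm (sqrtDensity β₁ ν - sqrtDensity β₂ ν) 2 ν = 0 := by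
    simpa [ENNReal.div_eq_zero_iff] using h3
  rw [eLpNorm_eq_zero_iff ((measurable_sqrtDensity β₁ ν).sub
    (measurable_sqrtDensity β₂ ν)).aestronglyMeasurable two_ne_zero] at h4
  refine eq_of_sqrtDensity_ae_eq h₁ h₂ ?_
  filter_upwards [h4] with x hx
  exact sub_eq_zero.1 hx

end Energy

/-- the functional `F̂(β) = −H_ν(β) − W²(μ, β)` has a unique maximizer over
Borel probability measures on `Y`, and the maximum value is finite. -/
theorem Fhat_unique_maximizer
    {n : ℕ} (X Y : Set (EuclideanSpace ℝ (Fin n)))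
    (hXc : IsCompact X) (hXconv : Convex ℝ X) (hXint : (interior X).Nonempty)
    (hYc : IsCompact Y) (hYconv : Convex ℝ Y) (hYint : (interior Y).Nonempty)
    (μ : Measure (EuclideanSpace ℝ (Fin n))) [IsProbabilityMeasure μ]
    (hμX : μ Xᶜ = 0) (hμac : μ ≪ volume)
    (ν : Measure (EuclideanSpace ℝ (Fin n))) [IsProbabilityMeasure ν]
    (hνY : ν Yᶜ = 0) (hνac : ν ≪ volume)
    (a₁ a₂ : ℝ) (ha₁ : 0 < a₁)
    (hμdens : ∀ᵐ x ∂(volume.restrict X),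
      ENNReal.ofReal a₁ ≤ μ.rnDeriv volume x ∧ μ.rnDeriv volume x ≤ ENNReal.ofReal a₂)
    (b₁ b₂ : ℝ) (hb₁ : 0 < b₁)
    (hνdens : ∀ᵐ y ∂(volume.restrict Y),
      ENNReal.ofReal b₁ ≤ ν.rnDeriv volume y ∧ ν.rnDeriv volume y ≤ ENNReal.ofReal b₂) :
    ∃! β : Measure (EuclideanSpace ℝ (Fin n)),
      IsProbabilityMeasure β ∧ β Yᶜ = 0 ∧
      (∀ β' : Measure (EuclideanSpace ℝ (Fin n)), IsProbabilityMeasure β' → β' Yᶜ = 0 →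
        Fhat μ ν β' ≤ Fhat μ ν β) ∧
      Fhat μ ν β ≠ ⊥ ∧ Fhat μ ν β ≠ ⊤ := by
  have hμ : ∀ᵐ x ∂μ, x ∈ X := hμX
  have hν : ∀ᵐ x ∂ν, x ∈ Y := hνY
  obtain ⟨β, hβ, htop, hmin⟩ := exists_energy_minimizer hXc hYc hμ hν
  refine ⟨β, ⟨hβ, ac_of_energy_ne_top htop hνY, fun β' h' _ => ?_, ?_, ?_⟩, ?_⟩
  · rw [Fhat_eq_neg_energy, Fhat_eq_neg_energy, EReal.neg_le_neg_iff,
      EReal.coe_ennreal_le_coe_ennreal_iff]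
    exact hmin β' h'
  · rw [Fhat_eq_neg_energy]
    simpa using htop
  · rw [Fhat_eq_neg_energy]
    simp
  · rintro β' ⟨h', -, hmax, -, -⟩
    have hle := hmax β hβ (ac_of_energy_ne_top htop hνY)
    rw [Fhat_eq_neg_energy, Fhat_eq_neg_energy, EReal.neg_le_neg_iff,
      EReal.coe_ennreal_le_coe_ennreal_iff] at hle
    exact (energy_minimizer_unique hXc hYc hμ hν htop (le_antisymm hle (hmin β' h'))
      (hmin _ inferInstance)).symm
end
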